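/- Let F = {(x₀, x₁, y) ∈ ℝ³ : −1/2 < x₀ < 1/2, 0 < x₁ < 1/2, y > 0, x₀² + x₁² + y² > 1} be the standard fundamental domain of the Picard group in the upper half-space. Then its hyperbolic volume ∫∫∫_F y^{−3} dx₀ dx₁ dy equals (1/(2π²)) · Σ_{ν ∈ ℤ[i] ∖ {0}} (ν ν̄)^{−2}, where the sum runs over all nonzero Gaussian integers and ν̄ denotes complex conjugation; numerically this volume is 0.3053218647… . -/

import Mathlib

open MeasureTheory

/-- The classes of associated Gaussian integers of norm `n`. -/
def gaussianClasses (n : ℕ) : Set (Associates GaussianInt) :=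
  Associates.mk '' {ν | ν.norm.natAbs = n}

namespace GaussianInt

theorem natAbs_norm_mul (a b : GaussianInt) :
    (a * b).norm.natAbs = a.norm.natAbs * b.norm.natAbs := by
  rw [Zsqrtd.norm_mul, Int.natAbs_mul]

theorem natAbs_norm_pow (a : GaussianInt) (k : ℕ) :
    (a ^ k).norm.natAbs = a.norm.natAbs ^ k := by
  induction k with
  | zero => simp
  | succ k ih => rw [pow_succ, natAbs_norm_mul, ih, pow_succ]

theorem natAbs_norm_natCast (n : ℕ) : (n : GaussianInt).norm.natAbs = n ^ 2 := by
  rw [Zsqrtd.norm_natCast]; norm_cast; ring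

theorem natAbs_norm_star (a : GaussianInt) : (star a).norm.natAbs = a.norm.natAbs := by
  rw [Zsqrtd.norm_conj]

theorem mul_star_eq_natAbs_norm (a : GaussianInt) :
    a * star a = (a.norm.natAbs : GaussianInt) := by
  rw [← Zsqrtd.norm_eq_mul_conj, ← Int.cast_natCast, abs_natCast_norm]

theorem dvd_natAbs_norm (a : GaussianInt) : a ∣ (a.norm.natAbs : GaussianInt) :=
  ⟨star a, (mul_star_eq_natAbs_norm a).symm⟩

theorem natAbs_norm_dvd {a b : GaussianInt} (h : a ∣ b) : a.norm.natAbs ∣ b.norm.natAbs := by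
  obtain ⟨c, rfl⟩ := h
  exact ⟨_, natAbs_norm_mul a c⟩

theorem natAbs_norm_eq_of_associated {a b : GaussianInt} (h : Associated a b) :
    a.norm.natAbs = b.norm.natAbs :=
  Nat.dvd_antisymm (natAbs_norm_dvd h.dvd) (natAbs_norm_dvd h.symm.dvd)

theorem natAbs_norm_eq_sq_add_sq (a : GaussianInt) :
    a.norm.natAbs = a.re.natAbs ^ 2 + a.im.natAbs ^ 2 := by
  rw [natAbs_norm_eq]; ring

theorem finite_setOf_natAbs_norm_eq (n : ℕ) : {ν : GaussianInt | ν.norm.natAbs = n}.Finite := by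
  refine Set.Finite.subset (((Set.finite_Icc (-n : ℤ) n).prod (Set.finite_Icc (-n : ℤ) n)).image
    fun p : ℤ × ℤ => (⟨p.1, p.2⟩ : GaussianInt)) fun ν hν => ?_
  rw [Set.mem_ofPred_eq, natAbs_norm_eq_sq_add_sq] at hν
  have h1 : ν.re.natAbs ≤ n := by nlinarith
  have h2 : ν.im.natAbs ≤ n := by nlinarith
  exact ⟨(ν.re, ν.im), ⟨by simp only [Set.mem_Icc]; omega, by simp only [Set.mem_Icc]; omega⟩, rfl⟩

end GaussianInt

open GaussianInt

theorem finite_gaussianClasses (n : ℕ) : (gaussianClasses n).Finite :=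
  (finite_setOf_natAbs_norm_eq n).image _

theorem isCoprime_of_coprime_natAbs_norm {a b : GaussianInt}
    (h : a.norm.natAbs.Coprime b.norm.natAbs) : IsCoprime a b := by
  have h1 : IsCoprime (a.norm.natAbs : ℤ) (b.norm.natAbs : ℤ) := Nat.isCoprime_iff_coprime.2 h
  have h2 := h1.map (Int.castRingHom GaussianInt)
  simp only [eq_intCast, Int.cast_natCast] at h2
  exact h2.of_isCoprime_of_dvd_left (dvd_natAbs_norm a) |>.of_isCoprime_of_dvd_right
    (dvd_natAbs_norm b)

theorem ncard_gaussianClasses_mul {m n : ℕ} (h : m.Coprime n) :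
    (gaussianClasses (m * n)).ncard = (gaussianClasses m).ncard * (gaussianClasses n).ncard := by
  rw [← Set.ncard_prod]
  have himg : gaussianClasses (m * n) =
      (fun p : Associates GaussianInt × Associates GaussianInt => p.1 * p.2) ''
        (gaussianClasses m ×ˢ gaussianClasses n) := by
    ext x
    constructor
    · rintro ⟨ν, hν, rfl⟩
      have hdvd : ν ∣ (m : GaussianInt) * (n : GaussianInt) := by
        have := dvd_natAbs_norm ν
        rwa [hν, Nat.cast_mul] at this
      obtain ⟨a, b, ha, hb, rfl⟩ := exists_dvd_and_dvd_of_dvd_mul hdvd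
      have ha' := natAbs_norm_dvd ha
      have hb' := natAbs_norm_dvd hb
      rw [natAbs_norm_natCast] at ha' hb'
      rw [Set.mem_ofPred_eq, natAbs_norm_mul] at hν
      have hc1 : (a.norm.natAbs).Coprime n := (h.pow_left 2).coprime_dvd_left ha'
      have hc2 : (b.norm.natAbs).Coprime m := (h.symm.pow_left 2).coprime_dvd_left hb'
      have e1 : a.norm.natAbs = m := Nat.dvd_antisymm
        (hc1.dvd_of_dvd_mul_right (hν ▸ dvd_mul_right _ _))
        (hc2.symm.dvd_of_dvd_mul_right (hν ▸ dvd_mul_right _ _))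
      have e2 : b.norm.natAbs = n := Nat.dvd_antisymm
        (hc2.dvd_of_dvd_mul_left (hν ▸ dvd_mul_left _ _))
        (hc1.symm.dvd_of_dvd_mul_left (hν ▸ dvd_mul_left _ _))
      exact ⟨(Associates.mk a, Associates.mk b), ⟨⟨a, e1, rfl⟩, ⟨b, e2, rfl⟩⟩, rfl⟩
    · rintro ⟨⟨_, _⟩, ⟨⟨a, ha, rfl⟩, ⟨b, hb, rfl⟩⟩, rfl⟩
      refine ⟨a * b, ?_, rfl⟩
      rw [Set.mem_ofPred_eq] at ha hb ⊢
      rw [natAbs_norm_mul, ha, hb]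
  rw [himg]
  apply Set.InjOn.ncard_image
  rintro ⟨_, _⟩ ⟨⟨a, ha, rfl⟩, ⟨b, hb, rfl⟩⟩ ⟨_, _⟩ ⟨⟨c, hc, rfl⟩, ⟨d, hd, rfl⟩⟩ heq
  rw [Set.mem_ofPred_eq] at ha hb hc hd
  have hassoc : Associated (a * b) (c * d) := by
    rw [← Associates.mk_eq_mk_iff_associated]; exact heq
  have cop : ∀ x y : GaussianInt, x.norm.natAbs = m → y.norm.natAbs = n → IsCoprime x y :=
    fun x y hx hy => isCoprime_of_coprime_natAbs_norm (by rwa [hx, hy])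
  have h1 : Associated a c := associated_of_dvd_dvd
    ((cop a d ha hd).dvd_of_dvd_mul_right ((dvd_mul_right _ _).trans hassoc.dvd))
    ((cop c b hc hb).dvd_of_dvd_mul_right ((dvd_mul_right _ _).trans hassoc.symm.dvd))
  have h2 : Associated b d := associated_of_dvd_dvd
    ((cop c b hc hb).symm.dvd_of_dvd_mul_left ((dvd_mul_left _ _).trans hassoc.dvd))
    ((cop a d ha hd).symm.dvd_of_dvd_mul_left ((dvd_mul_left _ _).trans hassoc.symm.dvd))
  rw [Associates.mk_eq_mk_iff_associated.2 h1, Associates.mk_eq_mk_iff_associated.2 h2]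

theorem dvd_natCast_pow_of_natAbs_norm_eq {p k : ℕ} {ν : GaussianInt}
    (h : ν.norm.natAbs = p ^ k) : ν ∣ (p : GaussianInt) ^ k := by
  have := dvd_natAbs_norm ν
  rwa [h, Nat.cast_pow] at this

theorem ncard_gaussianClasses_pow_of_inert {p : ℕ} (hp : p.Prime)
    (hP : Prime (p : GaussianInt)) (k : ℕ) :
    (gaussianClasses (p ^ k)).ncard = if Even k then 1 else 0 := by
  have key : ∀ ν : GaussianInt, ν.norm.natAbs = p ^ k →
      ∃ j, k = 2 * j ∧ Associated ν ((p : GaussianInt) ^ j) := by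
    intro ν hν
    obtain ⟨j, -, hj⟩ := (dvd_prime_pow hP k).1 (dvd_natCast_pow_of_natAbs_norm_eq hν)
    refine ⟨j, ?_, hj⟩
    have := natAbs_norm_eq_of_associated hj
    rw [hν, natAbs_norm_pow, natAbs_norm_natCast, ← pow_mul] at this
    exact Nat.pow_right_injective hp.two_le this
  split_ifs with hk
  · obtain ⟨j, rfl⟩ := hk
    rw [Set.ncard_eq_one]
    refine ⟨Associates.mk ((p : GaussianInt) ^ j), Set.eq_singleton_iff_unique_mem.2 ⟨?_, ?_⟩⟩
    · refine ⟨_, ?_, rfl⟩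
      rw [Set.mem_ofPred_eq, natAbs_norm_pow, natAbs_norm_natCast, ← pow_mul, two_mul]
    · rintro _ ⟨ν, hν, rfl⟩
      obtain ⟨i, hi, h⟩ := key ν hν
      obtain rfl : j = i := by omega
      exact Associates.mk_eq_mk_iff_associated.2 h
  · rw [Set.ncard_eq_zero (finite_gaussianClasses _), Set.eq_empty_iff_forall_notMem]
    rintro _ ⟨ν, hν, rfl⟩
    obtain ⟨i, hi, -⟩ := key ν hν
    exact hk ⟨i, by omega⟩

theorem prime_of_prime_natAbs_norm {π : GaussianInt} (h : π.norm.natAbs.Prime) : Prime π := by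
  rw [← irreducible_iff_prime]
  refine ⟨fun hu => h.ne_one (Zsqrtd.norm_eq_one_iff.2 hu), fun a b hab => ?_⟩
  rw [hab, natAbs_norm_mul] at h
  rcases Nat.prime_mul_iff.1 h with ⟨-, h⟩ | ⟨-, h⟩
  · exact Or.inr (Zsqrtd.norm_eq_one_iff.1 h)
  · exact Or.inl (Zsqrtd.norm_eq_one_iff.1 h)

theorem ncard_gaussianClasses_two_pow (k : ℕ) : (gaussianClasses (2 ^ k)).ncard = 1 := by
  set π : GaussianInt := ⟨1, 1⟩ with hπ
  have hN : π.norm.natAbs = 2 := rfl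
  have hP : Prime π := prime_of_prime_natAbs_norm (by rw [hN]; exact Nat.prime_two)
  have h2 : ((2 : ℕ) : GaussianInt) ∣ π ^ 2 := ⟨⟨0, 1⟩, by rw [hπ]; decide⟩
  rw [Set.ncard_eq_one]
  refine ⟨Associates.mk (π ^ k), Set.eq_singleton_iff_unique_mem.2 ⟨?_, ?_⟩⟩
  · refine ⟨_, ?_, rfl⟩
    rw [Set.mem_ofPred_eq, natAbs_norm_pow, hN]
  · rintro _ ⟨ν, hν, rfl⟩
    have hd : ν ∣ π ^ (2 * k) := by
      rw [pow_mul]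
      exact (dvd_natCast_pow_of_natAbs_norm_eq hν).trans (pow_dvd_pow_of_dvd h2 k)
    obtain ⟨j, -, hj⟩ := (dvd_prime_pow hP _).1 hd
    have := natAbs_norm_eq_of_associated hj
    rw [hν, natAbs_norm_pow, hN] at this
    rw [Nat.pow_right_injective le_rfl this]
    exact Associates.mk_eq_mk_iff_associated.2 hj

theorem not_dvd_star_of_natAbs_norm_eq {p : ℕ} (hp : p.Prime) (hp2 : p ≠ 2) {π : GaussianInt}
    (hN : π.norm.natAbs = p) : ¬ π ∣ star π := by
  intro h
  have hs : π ∣ ((2 * π.re : ℤ) : GaussianInt) := by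
    have h1 : ((2 * π.re : ℤ) : GaussianInt) = π + star π := by
      ext <;> simp [two_mul]
    rw [h1]
    exact dvd_add dvd_rfl h
  have h3 := natAbs_norm_dvd hs
  rw [hN, Zsqrtd.norm_intCast, Int.natAbs_mul, Int.natAbs_mul] at h3
  have h4 : p ∣ π.re.natAbs := by
    have h5 : p ∣ 2 * π.re.natAbs := by
      rcases hp.dvd_mul.1 h3 with h | h <;> exact h
    rcases hp.dvd_mul.1 h5 with h | h
    · exact absurd ((Nat.prime_dvd_prime_iff_eq hp Nat.prime_two).1 h) hp2
    · exact h
  rw [natAbs_norm_eq_sq_add_sq] at hN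
  have h6 : p ∣ π.im.natAbs := by
    refine hp.dvd_of_dvd_pow (n := 2) ((Nat.dvd_add_right (h4.trans (dvd_pow_self _ two_ne_zero))).1
      (hN ▸ dvd_rfl))
  have h7 : p ^ 2 ∣ p := by
    conv_rhs => rw [← hN]
    exact dvd_add (pow_dvd_pow_of_dvd h4 2) (pow_dvd_pow_of_dvd h6 2)
  have := Nat.le_of_dvd hp.pos h7
  nlinarith [hp.two_le]

theorem ncard_gaussianClasses_pow_of_split {p : ℕ} (hp : p.Prime) (hp2 : p ≠ 2) {π : GaussianInt}
    (hN : π.norm.natAbs = p) (k : ℕ) : (gaussianClasses (p ^ k)).ncard = k + 1 := by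
  have hN' : (star π).norm.natAbs = p := by rw [natAbs_norm_star, hN]
  have hP : Prime π := prime_of_prime_natAbs_norm (by rwa [hN])
  have hP' : Prime (star π) := prime_of_prime_natAbs_norm (by rwa [hN'])
  have hnd := not_dvd_star_of_natAbs_norm_eq hp hp2 hN
  have himg : gaussianClasses (p ^ k) =
      (fun j => Associates.mk (π ^ j * star π ^ (k - j))) '' (Finset.range (k + 1)) := by
    ext x
    constructor
    · rintro ⟨ν, hν, rfl⟩
      have hd := dvd_natCast_pow_of_natAbs_norm_eq hν
      rw [← hN, ← mul_star_eq_natAbs_norm, mul_pow] at hd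
      obtain ⟨a, b, ha, hb, rfl⟩ := exists_dvd_and_dvd_of_dvd_mul hd
      obtain ⟨i, -, hi⟩ := (dvd_prime_pow hP _).1 ha
      obtain ⟨j, -, hj⟩ := (dvd_prime_pow hP' _).1 hb
      rw [Set.mem_ofPred_eq, natAbs_norm_mul, natAbs_norm_eq_of_associated hi,
        natAbs_norm_eq_of_associated hj, natAbs_norm_pow, natAbs_norm_pow, hN, hN', ← pow_add] at hν
      have hij := Nat.pow_right_injective hp.two_le hν
      refine ⟨i, by simp; omega, ?_⟩
      obtain rfl : j = k - i := by omega
      exact Associates.mk_eq_mk_iff_associated.2 (hi.mul_mul hj).symm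
    · rintro ⟨j, hj, rfl⟩
      refine ⟨_, ?_, rfl⟩
      simp only [Finset.coe_range, Set.mem_Iio] at hj
      rw [Set.mem_ofPred_eq, natAbs_norm_mul, natAbs_norm_pow, natAbs_norm_pow, hN, hN', ← pow_add]
      congr 1; omega
  have hlt : ∀ i j : ℕ, i < j → j ≤ k →
      ¬ Associated (π ^ i * star π ^ (k - i)) (π ^ j * star π ^ (k - j)) := by
    intro i j hij hjk h
    have h1 : π ^ i * π ∣ π ^ i * star π ^ (k - i) := by
      rw [← pow_succ]
      exact ((pow_dvd_pow π hij).mul_right _).trans h.symm.dvd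
    exact hnd (hP.dvd_of_dvd_pow ((mul_dvd_mul_iff_left (pow_ne_zero i hP.ne_zero)).1 h1))
  rw [himg, Set.InjOn.ncard_image, Set.ncard_coe_finset, Finset.card_range]
  intro i hi j hj hij
  simp only [Finset.coe_range, Set.mem_Iio] at hi hj
  have hij' := Associates.mk_eq_mk_iff_associated.1 hij
  rcases lt_trichotomy i j with h | h | h
  · exact absurd hij' (hlt i j h (by omega))
  · exact h
  · exact absurd hij'.symm (hlt j i h (by omega))

/-- The quadratic character modulo `4` with complex values. -/
noncomputable def chiFour : DirichletCharacter ℂ 4 := ZMod.χ₄.ringHomComp (Int.castRingHom ℂ)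

theorem chiFour_natCast (n : ℕ) : chiFour (n : ZMod 4) = ((ZMod.χ₄ n : ℤ) : ℂ) := rfl

theorem ncard_gaussianClasses_prime_pow {p : ℕ} (hp : p.Prime) (k : ℕ) :
    ((gaussianClasses (p ^ k)).ncard : ℤ) = ∑ j ∈ Finset.range (k + 1), (ZMod.χ₄ p) ^ j := by
  have := Fact.mk hp
  rcases hp.eq_two_or_odd with rfl | hodd
  · rw [ncard_gaussianClasses_two_pow, ZMod.χ₄_nat_eq_if_mod_four]
    simp [Finset.sum_range_succ']
  · have h4 : p % 4 = 1 ∨ p % 4 = 3 := by omega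
    rcases h4 with h4 | h4
    · obtain ⟨a, b, hab⟩ := Nat.Prime.sq_add_sq (p := p) (by omega)
      have hN : (⟨a, b⟩ : GaussianInt).norm.natAbs = p := by
        rw [natAbs_norm_eq_sq_add_sq]; simpa using hab
      rw [ncard_gaussianClasses_pow_of_split hp (by rintro rfl; omega) hN,
        ZMod.χ₄_nat_one_mod_four h4]
      simp
    · rw [ncard_gaussianClasses_pow_of_inert hp (prime_of_nat_prime_of_mod_four_eq_three p h4),
        ZMod.χ₄_nat_three_mod_four h4, neg_one_geom_sum]
      by_cases hk : Even k <;> simp [hk, Nat.even_add_one]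

open ArithmeticFunction in
theorem zetaMul_chiFour_apply {n : ℕ} (hn : n ≠ 0) :
    chiFour.zetaMul n = (gaussianClasses n).ncard := by
  let f : ArithmeticFunction ℂ := ⟨fun n => if n = 0 then 0 else (gaussianClasses n).ncard, by simp⟩
  have hf : f.IsMultiplicative := by
    rw [IsMultiplicative.iff_ne_zero]
    constructor
    · have := ncard_gaussianClasses_two_pow 0
      rw [pow_zero] at this
      simp [f, this]
    · intro m n hm hn h
      simp [f, hm, hn, ncard_gaussianClasses_mul h]
  have : chiFour.zetaMul = f := by
    rw [IsMultiplicative.eq_iff_eq_on_prime_powers _ chiFour.isMultiplicative_zetaMul _ hf]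
    intro p k hp
    have h1 := congrArg (Int.cast : ℤ → ℂ) (ncard_gaussianClasses_prime_pow hp k)
    have h2 : chiFour.zetaMul (p ^ k) =
        ∑ d ∈ (p ^ k).divisors, toArithmeticFunction (chiFour ·) d := coe_zeta_mul_apply
    rw [h2, Nat.sum_divisors_prime_pow hp]
    simp only [f, toArithmeticFunction, coe_mk, pow_eq_zero_iff', hp.ne_zero,
      ne_eq, false_and, ↓reduceIte, Nat.cast_pow, map_pow, chiFour_natCast]
    rw [Int.cast_natCast, Int.cast_sum] at h1
    rw [h1]
  rw [this]
  simp [f, hn]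

theorem GaussianInt.isUnit_iff_eq {u : GaussianInt} :
    IsUnit u ↔ u = 1 ∨ u = -1 ∨ u = ⟨0, 1⟩ ∨ u = ⟨0, -1⟩ := by
  rw [← Zsqrtd.norm_eq_one_iff, natAbs_norm_eq_sq_add_sq]
  constructor
  · intro h
    have h1 : u.re.natAbs ≤ 1 := by nlinarith
    have h2 : u.im.natAbs ≤ 1 := by nlinarith
    have h3 : u.re.natAbs = 0 ∧ u.im.natAbs = 1 ∨ u.re.natAbs = 1 ∧ u.im.natAbs = 0 := by
      interval_cases u.re.natAbs <;> interval_cases u.im.natAbs <;> simp_all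
    simp only [Zsqrtd.ext_iff, Zsqrtd.re_one, Zsqrtd.im_one, Zsqrtd.re_neg, Zsqrtd.im_neg]
    omega
  · rintro (rfl | rfl | rfl | rfl) <;> rfl

theorem GaussianInt.associated_iff_eq {a b : GaussianInt} :
    Associated a b ↔ b = a ∨ b = -a ∨ b = a * ⟨0, 1⟩ ∨ b = a * ⟨0, -1⟩ := by
  constructor
  · rintro ⟨u, rfl⟩
    rcases isUnit_iff_eq.1 u.isUnit with h | h | h | h <;> simp [h]
  · have key : ∀ u : GaussianInt, IsUnit u → Associated a (a * u) :=
      fun u hu => (associated_mul_unit_right a u hu)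
    rintro (rfl | rfl | rfl | rfl)
    · rfl
    · simp
    · exact key _ (isUnit_iff_eq.2 (by simp))
    · exact key _ (isUnit_iff_eq.2 (by simp))

theorem ncard_natAbs_norm_eq {n : ℕ} (hn : n ≠ 0) :
    {ν : GaussianInt | ν.norm.natAbs = n}.ncard = 4 * (gaussianClasses n).ncard := by
  classical
  have hs := finite_setOf_natAbs_norm_eq n
  have ht := finite_gaussianClasses n
  rw [Set.ncard_eq_toFinset_card _ hs, Set.ncard_eq_toFinset_card _ ht,
    Finset.card_eq_sum_card_fiberwise (f := Associates.mk) (t := ht.toFinset)]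
  · rw [Finset.sum_const_nat (m := 4), mul_comm]
    intro x hx
    obtain ⟨μ, hμ, rfl⟩ := (Set.Finite.mem_toFinset ht).1 hx
    rw [Set.mem_ofPred_eq] at hμ
    have hset : {a ∈ hs.toFinset | Associates.mk a = Associates.mk μ} =
        {μ, -μ, μ * ⟨0, 1⟩, μ * ⟨0, -1⟩} := by
      ext a
      simp only [Finset.mem_filter, Set.Finite.mem_toFinset, Set.mem_ofPred_eq,
        Associates.mk_eq_mk_iff_associated, Finset.mem_insert, Finset.mem_singleton]
      rw [Associated.comm, associated_iff_eq, and_iff_right_iff_imp, ← associated_iff_eq]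
      exact fun h => (natAbs_norm_eq_of_associated h).symm.trans hμ
    have h0 : ¬ (μ.re = 0 ∧ μ.im = 0) := by
      rintro ⟨h1, h2⟩
      rw [natAbs_norm_eq_sq_add_sq, h1, h2] at hμ
      exact hn hμ.symm
    rw [hset]
    repeat rw [Finset.card_insert_of_notMem]
    · simp
    all_goals
      simp only [Finset.mem_insert, Finset.mem_singleton, Zsqrtd.ext_iff, Zsqrtd.re_neg,
        Zsqrtd.im_neg, Zsqrtd.re_mul, Zsqrtd.im_mul]
      omega
  · intro ν hν
    rw [Finset.mem_coe, Set.Finite.mem_toFinset] at hν ⊢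
    exact ⟨ν, hν, rfl⟩

/-- Catalan's constant. -/
noncomputable def catalanConstant : ℝ := ∑' k : ℕ, (-1) ^ k / (2 * k + 1 : ℝ) ^ 2

theorem summable_catalanConstant : Summable fun k : ℕ => (-1) ^ k / (2 * k + 1 : ℝ) ^ 2 := by
  have h : Summable fun n : ℕ => 1 / (n : ℝ) ^ 2 := Real.summable_one_div_nat_pow.2 one_lt_two
  have h2 : Function.Injective fun k : ℕ => 2 * k + 1 := fun a b h => by simpa using h
  refine ((h.comp_injective h2).of_norm_bounded (fun k => ?_))
  simp

theorem LSeries_chiFour_two : LSeries (chiFour ·) 2 = catalanConstant := by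
  have h2 : Function.Injective fun k : ℕ => 2 * k + 1 := fun a b h => by simpa using h
  rw [LSeries, ← h2.tsum_eq, catalanConstant, Complex.ofReal_tsum]
  · refine tsum_congr fun k => ?_
    rw [LSeries.term_of_ne_zero (by omega), chiFour_natCast, ZMod.χ₄_eq_neg_one_pow (by omega)]
    have : (2 * k + 1) / 2 = k := by omega
    rw [this]
    push_cast
    norm_cast
  · intro n hn
    by_contra h
    apply hn
    rcases eq_or_ne n 0 with rfl | h0
    · simp
    have he : n % 2 = 0 := by
      by_contra h'
      exact h ⟨n / 2, by dsimp only; omega⟩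
    rw [LSeries.term_of_ne_zero h0, chiFour_natCast, ZMod.χ₄_nat_eq_if_mod_four]
    simp [he]

theorem hasSum_ncard_gaussianClasses :
    HasSum (fun n : ℕ => 4 * (gaussianClasses n).ncard * (n : ℝ) ^ (-2 : ℤ))
      (4 * (Real.pi ^ 2 / 6 * catalanConstant)) := by
  have hs : (1 : ℝ) < (2 : ℂ).re := by simp
  have h1 : LSeriesSummable (fun n : ℕ => (ArithmeticFunction.zeta n : ℂ)) 2 :=
    ArithmeticFunction.LSeriesSummable_zeta_iff.2 hs
  have h2 : LSeriesSummable (chiFour ·) 2 := ZMod.LSeriesSummable_of_one_lt_re chiFour hs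
  have h3 := h1.LSeriesHasSum
  have h4 := h2.LSeriesHasSum
  rw [ArithmeticFunction.LSeries_zeta_eq_riemannZeta hs, riemannZeta_two] at h3
  rw [LSeries_chiFour_two] at h4
  have h4' : LSeriesHasSum (fun n => toArithmeticFunction (chiFour ·) n) 2 catalanConstant :=
    (LSeriesHasSum_congr _ _ fun hn =>
      chiFour.apply_eq_toArithmeticFunction_apply hn).1 h4
  have h5 : LSeriesHasSum (fun n => chiFour.zetaMul n) 2 _ :=
    ArithmeticFunction.LSeriesHasSum_mul h3 h4'
  simp_rw [mul_assoc]
  refine HasSum.mul_left 4 ?_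
  rw [← Complex.hasSum_ofReal]
  push_cast
  rw [LSeriesHasSum] at h5
  convert h5 using 1
  ext n
  rcases eq_or_ne n 0 with rfl | hn
  · simp
  · rw [LSeries.term_of_ne_zero hn, zetaMul_chiFour_apply hn, div_eq_mul_inv, zpow_neg]
    norm_cast

theorem tsum_gaussianInt_norm_zpow :
    ∑' ν : {ν : GaussianInt // ν ≠ 0}, (((ν.1 * star ν.1).re : ℝ)) ^ (-2 : ℤ) =
      4 * (Real.pi ^ 2 / 6 * catalanConstant) := by
  have hterm : ∀ ν : {ν : GaussianInt // ν ≠ 0}, (((ν.1 * star ν.1).re : ℝ)) ^ (-2 : ℤ) =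
      (ν.1.norm.natAbs : ℝ) ^ (-2 : ℤ) := by
    intro ν
    rw [mul_star_eq_natAbs_norm]
    simp
  simp_rw [hterm]
  have hS := hasSum_ncard_gaussianClasses
  have hnn : ∀ n : ℕ, 0 ≤ 4 * ((gaussianClasses n).ncard : ℝ) * (n : ℝ) ^ (-2 : ℤ) :=
    fun n => by positivity
  have hE : ∑' ν : {ν : GaussianInt // ν ≠ 0},
      ENNReal.ofReal ((ν.1.norm.natAbs : ℝ) ^ (-2 : ℤ)) =
      ENNReal.ofReal (4 * (Real.pi ^ 2 / 6 * catalanConstant)) := by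
    rw [← hS.tsum_eq, ENNReal.ofReal_tsum_of_nonneg hnn hS.summable,
      ← (Equiv.sigmaFiberEquiv
        (fun ν : {ν : GaussianInt // ν ≠ 0} => ν.1.norm.natAbs)).tsum_eq, ENNReal.tsum_sigma']
    refine tsum_congr fun n => ?_
    have hc : ∀ ν : {ν : {ν : GaussianInt // ν ≠ 0} // ν.1.norm.natAbs = n},
        ENNReal.ofReal ((((Equiv.sigmaFiberEquiv (fun ν : {ν : GaussianInt // ν ≠ 0} =>
          ν.1.norm.natAbs)) ⟨n, ν⟩).1.norm.natAbs : ℝ) ^ (-2 : ℤ)) =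
        ENNReal.ofReal ((n : ℝ) ^ (-2 : ℤ)) := by
      rintro ⟨ν, rfl⟩
      rfl
    rw [tsum_congr hc]
    rcases eq_or_ne n 0 with rfl | hn
    · simp
    · let e : {ν : {ν : GaussianInt // ν ≠ 0} // ν.1.norm.natAbs = n} ≃
          {ν : GaussianInt | ν.norm.natAbs = n} :=
        { toFun := fun ν => ⟨ν.1.1, ν.2⟩
          invFun := fun ν => ⟨⟨ν.1, by
            rintro h
            have := ν.2
            simp only [h, Set.mem_ofPred_eq] at this
            exact hn this.symm⟩, ν.2⟩
          left_inv := fun ν => rfl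
          right_inv := fun ν => rfl }
      have := (finite_setOf_natAbs_norm_eq n).to_subtype
      have : Finite {ν : {ν : GaussianInt // ν ≠ 0} // ν.1.norm.natAbs = n} := Finite.of_equiv _ e.symm
      rw [ENNReal.tsum_const, ENat.card_eq_coe_natCard, Nat.card_congr e, Nat.card_coe_set_eq,
        ncard_natAbs_norm_eq hn, ENNReal.ofReal_mul (by positivity)]
      congr 1
      rw [ENat.toENNReal_coe, ← ENNReal.ofReal_natCast]
      push_cast
      rfl
  have hpos : 0 ≤ 4 * (Real.pi ^ 2 / 6 * catalanConstant) := hS.nonneg hnn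
  rw [← ENNReal.toReal_ofReal hpos, ← hE, ENNReal.tsum_toReal_eq (fun _ => ENNReal.ofReal_ne_top)]
  exact tsum_congr fun ν => (ENNReal.toReal_ofReal (by positivity)).symm

theorem intervalIntegrable_pow_mul_neg_log (m : ℕ) :
    IntervalIntegrable (fun t : ℝ => t ^ m * -Real.log t) volume 0 1 :=
  (intervalIntegral.intervalIntegrable_log'.neg).continuousOn_mul (by fun_prop)

theorem integral_pow_mul_neg_log (m : ℕ) :
    ∫ t in (0 : ℝ)..1, t ^ m * -Real.log t = 1 / (m + 1 : ℝ) ^ 2 := by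
  have hm : (m + 1 : ℝ) ≠ 0 := by positivity
  rw [intervalIntegral.integral_eq_sub_of_hasDerivAt_of_le zero_le_one
    (f := fun t : ℝ => -(t ^ m * (t * Real.log t)) / (m + 1) + t ^ (m + 1) / (m + 1) ^ 2)
    ?_ ?_ (intervalIntegrable_pow_mul_neg_log m)]
  · simp
  · have := Real.continuous_mul_log
    fun_prop
  · intro t ht
    have h1 := (((hasDerivAt_pow m t).mul ((hasDerivAt_id t).mul
      (Real.hasDerivAt_log ht.1.ne'))).neg.div_const (m + 1 : ℝ)).add
      ((hasDerivAt_pow (m + 1) t).div_const ((m + 1 : ℝ) ^ 2))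
    refine h1.congr_deriv ?_
    have := ht.1.ne'
    rcases m with _ | m
    · simp [this]
    · push_cast
      simp only [id, Pi.mul_apply]
      field_simp
      ring

/-- The difference between `∫ -log t / (1 + t²)` and a finite sum, controlled through a polynomial
`Q` with `D - Q(x)` divisible by `1 + x`. -/
theorem abs_mul_integral_neg_log_div_sub_sum_le {n m : ℕ} {p : ℕ → ℝ} {D : ℝ} {Q : ℝ → ℝ}
    (hQ : ∀ x, D - Q x = (1 + x) * ∑ k ∈ Finset.range n, p k * x ^ k)
    (hb : ∀ x ∈ Set.Icc (0 : ℝ) 1, |Q x| ≤ x ^ m) :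
    |D * (∫ t in (0 : ℝ)..1, -Real.log t / (1 + t ^ 2)) -
      ∑ k ∈ Finset.range n, p k / (2 * k + 1 : ℝ) ^ 2| ≤ 1 / (2 * m + 1 : ℝ) ^ 2 := by
  have hI : IntervalIntegrable (fun t : ℝ => -Real.log t / (1 + t ^ 2)) volume 0 1 := by
    have := (intervalIntegral.intervalIntegrable_log' (a := 0) (b := 1)).neg.continuousOn_mul
      (g := fun t : ℝ => (1 + t ^ 2)⁻¹) (by
        refine Continuous.continuousOn (Continuous.inv₀ (by fun_prop) fun t => by positivity))
    refine this.congr fun t _ => ?_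
    simp only [Pi.neg_apply]
    ring
  have hterm : ∀ k ∈ Finset.range n, IntervalIntegrable
      (fun t : ℝ => p k * (t ^ (2 * k) * -Real.log t)) volume 0 1 :=
    fun k _ => (intervalIntegrable_pow_mul_neg_log (2 * k)).const_mul _
  have hsum : ∑ k ∈ Finset.range n, p k / (2 * k + 1 : ℝ) ^ 2 =
      ∫ t in (0 : ℝ)..1, ∑ k ∈ Finset.range n, p k * (t ^ (2 * k) * -Real.log t) := by
    rw [intervalIntegral.integral_finsetSum hterm]
    refine Finset.sum_congr rfl fun k _ => ?_
    rw [intervalIntegral.integral_const_mul, integral_pow_mul_neg_log]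
    push_cast
    ring
  have hS : IntervalIntegrable
      (fun t : ℝ => ∑ k ∈ Finset.range n, p k * (t ^ (2 * k) * -Real.log t)) volume 0 1 := by
    have := IntervalIntegrable.sum (Finset.range n) hterm
    refine this.congr fun t _ => ?_
    simp
  rw [hsum, ← intervalIntegral.integral_const_mul, ← intervalIntegral.integral_sub
    (hI.const_mul D) hS, ← Real.norm_eq_abs]
  have hbd := integral_pow_mul_neg_log (2 * m)
  push_cast at hbd
  rw [← hbd]
  refine intervalIntegral.norm_integral_le_of_norm_le zero_le_one (ae_of_all _ fun t ht => ?_)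
    (intervalIntegrable_pow_mul_neg_log _)
  have hlog : 0 ≤ -Real.log t := neg_nonneg.2 (Real.log_nonpos ht.1.le ht.2)
  have h1 : 0 < 1 + t ^ 2 := by positivity
  have heq : D * (-Real.log t / (1 + t ^ 2)) -
      ∑ k ∈ Finset.range n, p k * (t ^ (2 * k) * -Real.log t) =
      Q (t ^ 2) * -Real.log t / (1 + t ^ 2) := by
    have h2 := hQ (t ^ 2)
    have h3 : ∑ k ∈ Finset.range n, p k * (t ^ (2 * k) * -Real.log t) =
        (∑ k ∈ Finset.range n, p k * (t ^ 2) ^ k) * -Real.log t := by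
      rw [Finset.sum_mul]
      refine Finset.sum_congr rfl fun k _ => ?_
      rw [pow_mul]; ring
    rw [h3]
    field_simp
    linear_combination (-Real.log t) * h2
  rw [heq, Real.norm_eq_abs, abs_div, abs_mul, abs_of_nonneg hlog, abs_of_pos h1, pow_mul]
  have h4 := hb (t ^ 2) ⟨by positivity, pow_le_one₀ ht.1.le ht.2⟩
  rw [div_le_iff₀ h1]
  have h5 : 0 ≤ (t ^ 2) ^ m * -Real.log t := by positivity
  nlinarith [mul_le_mul_of_nonneg_right h4 hlog, sq_nonneg t]

theorem integral_neg_log_div_one_add_sq :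
    ∫ t in (0 : ℝ)..1, -Real.log t / (1 + t ^ 2) = catalanConstant := by
  refine tendsto_nhds_unique ?_ summable_catalanConstant.hasSum.tendsto_sum_nat
  rw [tendsto_iff_dist_tendsto_zero]
  have hlim : Filter.Tendsto (fun n : ℕ => 1 / ((n : ℝ) + 1)) Filter.atTop (nhds 0) :=
    tendsto_one_div_add_atTop_nhds_zero_nat
  refine squeeze_zero (fun _ => dist_nonneg) (fun n => ?_) hlim
  have h := abs_mul_integral_neg_log_div_sub_sum_le (n := n) (m := n) (p := fun k => (-1) ^ k)
    (D := 1) (Q := fun x => (-x) ^ n) (fun x => by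
      have := mul_neg_geom_sum (-x) n
      rw [← this, sub_neg_eq_add]
      congr 1
      exact Finset.sum_congr rfl fun k _ => by rw [neg_pow]) (fun x hx => by
      rw [abs_pow, abs_neg, abs_of_nonneg hx.1])
  rw [one_mul] at h
  rw [dist_comm, Real.dist_eq]
  refine h.trans (one_div_le_one_div_of_le (by positivity) ?_)
  nlinarith [(Nat.cast_nonneg n : (0 : ℝ) ≤ n)]

theorem catalanConstant_bounds : 3 * 0.3053218647 ≤ catalanConstant ∧
    catalanConstant < 3 * 0.3053218648 := by
  have hsq : ∀ u : ℝ, |u| ≤ 1 → |2 * u ^ 2 - 1| ≤ 1 := by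
    intro u hu
    have h := abs_le.1 hu
    rw [abs_le]
    constructor <;> nlinarith
  -- the shifted Chebyshev polynomial of degree 16, as a fourfold iterate of `2 u² - 1`
  have h := abs_mul_integral_neg_log_div_sub_sum_le (n := 16) (m := 0)
    (p := fun k => ([
      886731088896, -886731088384, 886731044864, -886729582592, 886703783936,
      -886428598272, 884502298624, -875188322304, 843055104000, -762407026688,
      613844779008, -413189275648, 216895848448, -81604378624, 19327352832,
      -2147483648] : List ℝ).getD k 0)
    (D := 886731088897)
    (Q := fun x => 2 * (2 * (2 * (2 * (1 - 2 * x) ^ 2 - 1) ^ 2 - 1) ^ 2 - 1) ^ 2 - 1)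
    (fun x => by
      simp only [Finset.sum_range_succ, Finset.sum_range_zero, List.getD_cons_zero,
        List.getD_cons_succ]
      ring)
    (fun x hx => by
      rw [pow_zero]
      refine hsq _ (hsq _ (hsq _ (hsq _ ?_)))
      rw [abs_le]
      constructor <;> linarith [hx.1, hx.2])
  rw [integral_neg_log_div_one_add_sq, abs_le] at h
  simp only [Finset.sum_range_succ, Finset.sum_range_zero, List.getD_cons_zero,
    List.getD_cons_succ] at h
  norm_num at h ⊢
  constructor <;> linarith [h.1, h.2]

theorem Real.image_arctan_Ioo_zero_one : Real.arctan '' Set.Ioo 0 1 = Set.Ioo 0 (Real.pi / 4) := by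
  ext θ
  constructor
  · rintro ⟨t, ⟨h0, h1⟩, rfl⟩
    exact ⟨Real.arctan_pos.2 h0, Real.arctan_one ▸ Real.arctan_strictMono h1⟩
  · rintro ⟨h0, h1⟩
    have hθ : Real.arctan (Real.tan θ) = θ :=
      Real.arctan_tan (by linarith [Real.pi_pos]) (by linarith [Real.pi_pos])
    refine ⟨Real.tan θ, ⟨Real.tan_pos_of_pos_of_lt_pi_div_two h0 (by linarith [Real.pi_pos]), ?_⟩,
      hθ⟩
    rw [← Real.arctan_strictMono.lt_iff_lt, hθ, Real.arctan_one]
    exact h1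

theorem integral_div_one_add_sq_eq_integral_comp_tan (g : ℝ → ℝ) :
    ∫ t in (0 : ℝ)..1, g t / (1 + t ^ 2) = ∫ θ in (0 : ℝ)..Real.pi / 4, g (Real.tan θ) := by
  rw [intervalIntegral.integral_of_le zero_le_one,
    intervalIntegral.integral_of_le (by positivity), integral_Ioc_eq_integral_Ioo,
    integral_Ioc_eq_integral_Ioo, ← Real.image_arctan_Ioo_zero_one,
    integral_image_eq_integral_abs_deriv_smul measurableSet_Ioo
      (fun t _ => (Real.hasDerivAt_arctan t).hasDerivWithinAt) Real.arctan_injective.injOn]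
  refine integral_congr_ae (.of_forall fun t => ?_)
  have : (0 : ℝ) < 1 + t ^ 2 := by positivity
  simp only [Real.tan_arctan, smul_eq_mul, abs_of_pos (one_div_pos.2 this)]
  ring

theorem integral_log_cos_sub_integral_log_sin :
    (∫ θ in (0 : ℝ)..Real.pi / 4, Real.log (Real.cos θ)) -
      ∫ θ in (0 : ℝ)..Real.pi / 4, Real.log (Real.sin θ) = catalanConstant := by
  have hc : IntervalIntegrable (fun θ => Real.log (Real.cos θ)) volume 0 (Real.pi / 4) :=
    intervalIntegrable_log_cos
  have hs : IntervalIntegrable (fun θ => Real.log (Real.sin θ)) volume 0 (Real.pi / 4) :=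
    intervalIntegrable_log_sin
  rw [← integral_neg_log_div_one_add_sq, integral_div_one_add_sq_eq_integral_comp_tan
    (fun t => -Real.log t), ← intervalIntegral.integral_sub hc hs]
  refine intervalIntegral.integral_congr_Ioo_of_le (by positivity) fun θ hθ => ?_
  have h1 : 0 < Real.sin θ := Real.sin_pos_of_pos_of_lt_pi hθ.1 (by linarith [hθ.2, Real.pi_pos])
  have h2 : 0 < Real.cos θ := Real.cos_pos_of_mem_Ioo
    ⟨by linarith [hθ.1, Real.pi_pos], by linarith [hθ.2, Real.pi_pos]⟩
  simp only [Real.tan_eq_sin_div_cos, Real.log_div h1.ne' h2.ne']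
  ring

theorem integral_log_cos_add_integral_log_sin :
    (∫ θ in (0 : ℝ)..Real.pi / 4, Real.log (Real.cos θ)) +
      ∫ θ in (0 : ℝ)..Real.pi / 4, Real.log (Real.sin θ) = -(Real.pi / 2) * Real.log 2 := by
  have h := intervalIntegral.integral_comp_mul_left (a := 0) (b := Real.pi / 4)
    (fun θ => Real.log (Real.sin θ)) (two_ne_zero (α := ℝ))
  rw [mul_zero, show 2 * (Real.pi / 4) = Real.pi / 2 by ring, integral_log_sin_zero_pi_div_two]
    at h
  have h' : ∫ θ in (0 : ℝ)..Real.pi / 4, Real.log (Real.sin (2 * θ)) =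
      ∫ θ in (0 : ℝ)..Real.pi / 4,
        (Real.log 2 + (Real.log (Real.cos θ) + Real.log (Real.sin θ))) := by
    refine intervalIntegral.integral_congr_Ioo_of_le (by positivity) fun θ hθ => ?_
    have h1 : 0 < Real.sin θ := Real.sin_pos_of_pos_of_lt_pi hθ.1 (by linarith [hθ.2, Real.pi_pos])
    have h2 : 0 < Real.cos θ := Real.cos_pos_of_mem_Ioo
      ⟨by linarith [hθ.1, Real.pi_pos], by linarith [hθ.2, Real.pi_pos]⟩
    simp only [Real.sin_two_mul, Real.log_mul (mul_pos two_pos h1).ne' h2.ne',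
      Real.log_mul two_ne_zero h1.ne']
    ring
  have hc : IntervalIntegrable (fun θ => Real.log (Real.cos θ)) volume 0 (Real.pi / 4) :=
    intervalIntegrable_log_cos
  have hs : IntervalIntegrable (fun θ => Real.log (Real.sin θ)) volume 0 (Real.pi / 4) :=
    intervalIntegrable_log_sin
  rw [h', intervalIntegral.integral_add (by simp) (hc.add hs), intervalIntegral.integral_add hc hs,
    intervalIntegral.integral_const, smul_eq_mul, smul_eq_mul] at h
  linarith

theorem integral_log_sin_three_mul :
    ∫ θ in (0 : ℝ)..Real.pi / 4, Real.log (Real.sin (3 * θ)) =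
      1 / 3 * (-(Real.pi * Real.log 2) - ∫ θ in (0 : ℝ)..Real.pi / 4, Real.log (Real.sin θ)) := by
  have hs (a b : ℝ) : IntervalIntegrable (fun θ => Real.log (Real.sin θ)) volume a b :=
    intervalIntegrable_log_sin
  have h := intervalIntegral.integral_comp_mul_left (a := 0) (b := Real.pi / 4)
    (fun θ => Real.log (Real.sin θ)) (three_ne_zero (α := ℝ))
  have h2 := intervalIntegral.integral_comp_sub_left (a := 0) (b := Real.pi / 4)
    (fun θ => Real.log (Real.sin θ)) Real.pi
  have h3 := intervalIntegral.integral_add_adjacent_intervals (hs 0 (3 * (Real.pi / 4)))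
    (hs (3 * (Real.pi / 4)) Real.pi)
  rw [integral_log_sin_zero_pi] at h3
  simp only [Real.sin_pi_sub, sub_zero] at h2
  rw [show Real.pi - Real.pi / 4 = 3 * (Real.pi / 4) by ring] at h2
  rw [h, mul_zero, smul_eq_mul, h2]
  linarith

theorem integral_log_four_div_three_sub_sq_div_one_add_sq :
    ∫ t in (0 : ℝ)..1, Real.log (4 / (3 - t ^ 2)) / (1 + t ^ 2) = catalanConstant / 3 := by
  rw [integral_div_one_add_sq_eq_integral_comp_tan (fun t => Real.log (4 / (3 - t ^ 2)))]
  have hc : IntervalIntegrable (fun θ => Real.log (Real.cos θ)) volume 0 (Real.pi / 4) :=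
    intervalIntegrable_log_cos
  have hs (a b : ℝ) : IntervalIntegrable (fun θ => Real.log (Real.sin θ)) volume a b :=
    intervalIntegrable_log_sin
  have hs3 : IntervalIntegrable (fun θ => Real.log (Real.sin (3 * θ))) volume 0 (Real.pi / 4) := by
    have := (hs 0 (3 * (Real.pi / 4))).comp_mul_left (c := 3)
    simpa using this
  have key : ∫ θ in (0 : ℝ)..Real.pi / 4, Real.log (4 / (3 - Real.tan θ ^ 2)) =
      ∫ θ in (0 : ℝ)..Real.pi / 4, (2 * Real.log 2 + 2 * Real.log (Real.cos θ) +
        Real.log (Real.sin θ) - Real.log (Real.sin (3 * θ))) := by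
    refine intervalIntegral.integral_congr_Ioo_of_le (by positivity) fun θ hθ => ?_
    have h1 : 0 < Real.sin θ := Real.sin_pos_of_pos_of_lt_pi hθ.1 (by linarith [hθ.2, Real.pi_pos])
    have h2 : 0 < Real.cos θ := Real.cos_pos_of_mem_Ioo
      ⟨by linarith [hθ.1, Real.pi_pos], by linarith [hθ.2, Real.pi_pos]⟩
    have h3 : 0 < Real.sin (3 * θ) :=
      Real.sin_pos_of_pos_of_lt_pi (by linarith [hθ.1]) (by linarith [hθ.2, Real.pi_pos])
    have h4 : 4 / (3 - Real.tan θ ^ 2) =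
        2 ^ 2 * Real.cos θ ^ 2 * Real.sin θ / Real.sin (3 * θ) := by
      have e : Real.sin (3 * θ) = Real.sin θ * Real.cos θ ^ 2 * (3 - Real.tan θ ^ 2) := by
        rw [Real.sin_three_mul, Real.tan_eq_sin_div_cos]
        field_simp
        rw [Real.cos_sq']
        ring
      have h5 : 3 - Real.tan θ ^ 2 ≠ 0 := by
        intro h
        rw [h, mul_zero] at e
        exact h3.ne' e
      rw [e]
      field_simp
      norm_num
    rw [h4, Real.log_div (by positivity) h3.ne', Real.log_mul (by positivity) h1.ne',
      Real.log_mul (by positivity) (by positivity), Real.log_pow, Real.log_pow]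
    push_cast
    ring
  rw [key, intervalIntegral.integral_sub (((by simp : IntervalIntegrable
    (fun _ => 2 * Real.log 2) volume 0 (Real.pi / 4)).add (hc.const_mul 2)).add (hs _ _)) hs3,
    intervalIntegral.integral_add ((by simp : IntervalIntegrable
    (fun _ => 2 * Real.log 2) volume 0 (Real.pi / 4)).add (hc.const_mul 2)) (hs _ _),
    intervalIntegral.integral_add (by simp) (hc.const_mul 2),
    intervalIntegral.integral_const, intervalIntegral.integral_const_mul,
    integral_log_sin_three_mul, smul_eq_mul]
  linarith [integral_log_cos_add_integral_log_sin, integral_log_cos_sub_integral_log_sin]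

theorem setLIntegral_Ioo_neg_self_of_even {φ : ℝ → ENNReal} (hφ : ∀ x, φ (-x) = φ x) {a : ℝ}
    (ha : 0 < a) : ∫⁻ x in Set.Ioo (-a) a, φ x = 2 * ∫⁻ x in Set.Ioo 0 a, φ x := by
  have h : Set.Ioo (-a) a = Set.Ioc (-a) 0 ∪ Set.Ioo 0 a :=
    (Set.Ioc_union_Ioo_eq_Ioo (by linarith) ha).symm
  have h2 : ∫⁻ x in Set.Ioc (-a) 0, φ x = ∫⁻ x in Set.Ioo 0 a, φ x := by
    rw [← setLIntegral_congr Ioo_ae_eq_Ioc,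
      ← (Measure.measurePreserving_neg (volume : Measure ℝ)).setLIntegral_comp_preimage_emb
        (MeasurableEquiv.neg ℝ).measurableEmbedding φ (Set.Ioo (-a) 0)]
    simp [hφ]
  rw [h, lintegral_union measurableSet_Ioo
    (Set.disjoint_left.2 fun x hx hx' => absurd hx'.1 (not_lt.2 hx.2)), h2, two_mul]

theorem setLIntegral_setLIntegral_Ioo_of_symm {h : ℝ → ℝ → ENNReal}
    (hm : Measurable (Function.uncurry h)) (hs : ∀ x z, h x z = h z x) (a : ℝ) :
    ∫⁻ x in Set.Ioo 0 a, ∫⁻ z in Set.Ioo 0 a, h x z =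
      2 * ∫⁻ x in Set.Ioo 0 a, ∫⁻ z in Set.Ioo 0 x, h x z := by
  set A : ℝ → ℝ → ENNReal := fun x => (Set.Iio x).indicator (h x) with hA
  have hAm : Measurable (Function.uncurry A) := by
    have : Function.uncurry A = {p : ℝ × ℝ | p.2 < p.1}.indicator (Function.uncurry h) := by
      ext p
      simp [hA, Set.indicator_apply, Function.uncurry_def]
    rw [this]
    exact hm.indicator (measurableSet_lt measurable_snd measurable_fst)
  have split (x : ℝ) : ∫⁻ z in Set.Ioo 0 a, h x z =
      (∫⁻ z in Set.Ioo 0 a, A x z) + ∫⁻ z in Set.Ioo 0 a, A z x := by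
    have hAx : Measurable (A x) := hAm.comp measurable_prodMk_left
    rw [← lintegral_add_left hAx]
    refine lintegral_congr_ae ?_
    filter_upwards [Measure.ae_ne (volume.restrict (Set.Ioo 0 a)) x] with z hz
    rcases lt_or_gt_of_ne hz with hz | hz
    · simp [hA, hz, hz.le]
    · simp [hA, hz, hz.le, hs x z]
  have inner : ∀ x ∈ Set.Ioo 0 a,
      ∫⁻ z in Set.Ioo 0 a, A x z = ∫⁻ z in Set.Ioo 0 x, h x z := fun x hx => by
    rw [setLIntegral_indicator measurableSet_Iio, Set.inter_comm, Set.Ioo_inter_Iio,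
      min_eq_right hx.2.le]
  have hAi : Measurable fun x => ∫⁻ z in Set.Ioo 0 a, A x z := hAm.lintegral_prod_right'
  rw [lintegral_congr split, lintegral_add_left hAi,
    lintegral_lintegral_swap (f := fun x z => A z x) (hAm.comp measurable_swap).aemeasurable,
    ← two_mul, setLIntegral_congr_fun measurableSet_Ioo inner]

theorem setLIntegral_Ioo_eq_mul_comp_mul {x : ℝ} (hx : 0 < x) (g : ℝ → ENNReal) :
    ∫⁻ z in Set.Ioo 0 x, g z = ∫⁻ t in Set.Ioo 0 1, ENNReal.ofReal x * g (x * t) := by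
  have h : Set.Ioo 0 x = (fun t => x * t) '' Set.Ioo 0 1 := by
    rw [Set.image_mul_left_Ioo hx, mul_zero, mul_one]
  rw [h, lintegral_image_eq_lintegral_abs_deriv_mul measurableSet_Ioo
    (fun t _ => ((hasDerivAt_id' t).const_mul x).hasDerivWithinAt)
    (mul_right_injective₀ hx.ne').injOn]
  simp [abs_of_pos hx]

theorem setLIntegral_Ioi_one_div_cube {c : ℝ} (hc : 0 < c) :
    ∫⁻ y in Set.Ioi c, ENNReal.ofReal (1 / y ^ 3) = ENNReal.ofReal (1 / (2 * c ^ 2)) := by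
  have e : ∀ y ∈ Set.Ioi c, 1 / y ^ 3 = y ^ (-3 : ℝ) := fun y hy => by
    rw [Real.rpow_neg (hc.trans hy).le, one_div]
    norm_cast
  have hi : IntegrableOn (fun y : ℝ => y ^ (-3 : ℝ)) (Set.Ioi c) :=
    integrableOn_Ioi_rpow_of_lt (by norm_num) hc
  rw [setLIntegral_congr_fun measurableSet_Ioi fun y hy => congrArg ENNReal.ofReal (e y hy),
    ← ofReal_integral_eq_lintegral_ofReal hi, integral_Ioi_rpow_of_lt (by norm_num) hc]
  · congr 1
    rw [show (-3 + 1 : ℝ) = -(2 : ℕ) by norm_num, Real.rpow_neg hc.le, Real.rpow_natCast]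
    push_cast
    field_simp
  · exact (ae_restrict_mem measurableSet_Ioi).mono fun y hy => Real.rpow_nonneg (hc.trans hy).le _

theorem setLIntegral_picard_domain_one_div_cube :
    ∫⁻ p in {p : ℝ × ℝ × ℝ | -(1/2) < p.1 ∧ p.1 < 1/2 ∧ 0 < p.2.1 ∧
        p.2.1 < 1/2 ∧ 0 < p.2.2 ∧ 1 < p.1 ^ 2 + p.2.1 ^ 2 + p.2.2 ^ 2},
      ENNReal.ofReal (1 / p.2.2 ^ 3) =
    ∫⁻ x in Set.Ioo (-(1 / 2) : ℝ) (1 / 2), ∫⁻ z in Set.Ioo (0 : ℝ) (1 / 2),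
      ENNReal.ofReal (1 / (2 * (1 - (x ^ 2 + z ^ 2)))) := by
  have hE : MeasurableSet {p : ℝ × ℝ × ℝ | -(1/2) < p.1 ∧ p.1 < 1/2 ∧ 0 < p.2.1 ∧
      p.2.1 < 1/2 ∧ 0 < p.2.2 ∧ 1 < p.1 ^ 2 + p.2.1 ^ 2 + p.2.2 ^ 2} := by
    measurability
  set E := {p : ℝ × ℝ × ℝ | -(1/2) < p.1 ∧ p.1 < 1/2 ∧ 0 < p.2.1 ∧
      p.2.1 < 1/2 ∧ 0 < p.2.2 ∧ 1 < p.1 ^ 2 + p.2.1 ^ 2 + p.2.2 ^ 2} with hEdef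
  have hmeas : Measurable (E.indicator fun p : ℝ × ℝ × ℝ => ENNReal.ofReal (1 / p.2.2 ^ 3)) :=
    Measurable.indicator (by fun_prop) hE
  rw [← lintegral_indicator hE, Measure.volume_eq_prod, lintegral_prod _ hmeas.aemeasurable,
    ← lintegral_indicator measurableSet_Ioo]
  refine lintegral_congr fun x => ?_
  have hmeasx : Measurable fun q : ℝ × ℝ =>
      E.indicator (fun p : ℝ × ℝ × ℝ => ENNReal.ofReal (1 / p.2.2 ^ 3)) (x, q) :=
    hmeas.comp measurable_prodMk_left
  rw [Measure.volume_eq_prod, lintegral_prod _ hmeasx.aemeasurable]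
  by_cases hx : x ∈ Set.Ioo (-(1 / 2) : ℝ) (1 / 2)
  · rw [Set.indicator_of_mem hx, ← lintegral_indicator measurableSet_Ioo]
    refine lintegral_congr fun z => ?_
    by_cases hz : z ∈ Set.Ioo (0 : ℝ) (1 / 2)
    · have hr : 0 < 1 - (x ^ 2 + z ^ 2) := by nlinarith [hx.1, hx.2, hz.1, hz.2]
      rw [Set.indicator_of_mem hz, ← Real.sq_sqrt hr.le,
        ← setLIntegral_Ioi_one_div_cube (Real.sqrt_pos.2 hr),
        ← lintegral_indicator measurableSet_Ioi]
      refine lintegral_congr fun y => ?_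
      have : (x, z, y) ∈ E ↔ y ∈ Set.Ioi (Real.sqrt (1 - (x ^ 2 + z ^ 2))) := by
        rw [hEdef, Set.mem_ofPred_eq, Set.mem_Ioi]
        constructor
        · rintro ⟨-, -, -, -, hy, h⟩
          exact (Real.sqrt_lt' hy).2 (by linarith)
        · intro h
          have hy := (Real.sqrt_nonneg _).trans_lt h
          exact ⟨hx.1, hx.2, hz.1, hz.2, hy, by linarith [(Real.sqrt_lt' hy).1 h]⟩
      simp only [Set.indicator_apply, this]
    · rw [Set.indicator_of_notMem hz]
      refine (lintegral_congr fun y => Set.indicator_of_notMem (fun h => hz ?_) _).trans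
        lintegral_zero
      exact ⟨h.2.2.1, h.2.2.2.1⟩
  · rw [Set.indicator_of_notMem hx]
    refine (lintegral_congr fun z => (lintegral_congr fun y =>
      Set.indicator_of_notMem (fun h => hx ?_) _).trans lintegral_zero).trans lintegral_zero
    exact ⟨h.1, h.2.1⟩

theorem setLIntegral_Ioo_div_one_sub {t : ℝ} (ht : t ∈ Set.Ioo (0 : ℝ) 1) :
    ∫⁻ x in Set.Ioo (0 : ℝ) (1 / 2), ENNReal.ofReal (x / (2 * (1 - x ^ 2 * (1 + t ^ 2)))) =
      ENNReal.ofReal (1 / 4 * (Real.log (4 / (3 - t ^ 2)) / (1 + t ^ 2))) := by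
  have ht2 : t ^ 2 < 1 := by nlinarith [ht.1, ht.2]
  have hpos : ∀ x ∈ Set.Icc (0 : ℝ) (1 / 2), 0 < 1 - x ^ 2 * (1 + t ^ 2) := fun x hx => by
    have : x ^ 2 ≤ 1 / 4 := by nlinarith [hx.1, hx.2]
    nlinarith [sq_nonneg t]
  have h1 : 0 < 1 + t ^ 2 := by positivity
  have h3 : 0 < 3 - t ^ 2 := by linarith
  have hcont : ContinuousOn (fun x : ℝ => x / (2 * (1 - x ^ 2 * (1 + t ^ 2))))
      (Set.Icc 0 (1 / 2)) :=
    ContinuousOn.div (by fun_prop) (by fun_prop) fun x hx => by linarith [hpos x hx]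
  have hint : IntegrableOn (fun x : ℝ => x / (2 * (1 - x ^ 2 * (1 + t ^ 2))))
      (Set.Ioo 0 (1 / 2)) := hcont.integrableOn_Icc.mono_set Set.Ioo_subset_Icc_self
  rw [← ofReal_integral_eq_lintegral_ofReal hint
    ((ae_restrict_mem measurableSet_Ioo).mono fun x hx =>
      div_nonneg hx.1.le (by linarith [hpos x ⟨hx.1.le, hx.2.le⟩])),
    ← integral_Ioc_eq_integral_Ioo, ← intervalIntegral.integral_of_le (by norm_num),
    intervalIntegral.integral_eq_sub_of_hasDerivAt_of_le (by norm_num)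
      (f := fun x => -Real.log (1 - x ^ 2 * (1 + t ^ 2)) / (4 * (1 + t ^ 2)))]
  · congr 1
    have e : (1 : ℝ) - (1 / 2) ^ 2 * (1 + t ^ 2) = (4 / (3 - t ^ 2))⁻¹ := by
      rw [inv_div]
      ring
    rw [e, Real.log_inv]
    simp
    field_simp
  · refine ContinuousOn.div_const (ContinuousOn.neg (ContinuousOn.log (by fun_prop) fun x hx => ?_)) _
    exact (hpos x hx).ne'
  · intro x hx
    have hx' := hpos x ⟨hx.1.le, hx.2.le⟩
    refine (((((hasDerivAt_pow 2 x).mul_const (1 + t ^ 2)).const_sub 1).log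
      hx'.ne').neg.div_const (4 * (1 + t ^ 2))).congr_deriv ?_
    have := hx'.ne'
    field_simp
    norm_num
    ring
  · exact (hcont.intervalIntegrable_of_Icc (by norm_num))

theorem setLIntegral_Ioo_one_div_one_sub_sq_add_sq :
    ∫⁻ x in Set.Ioo (-(1 / 2) : ℝ) (1 / 2), ∫⁻ z in Set.Ioo (0 : ℝ) (1 / 2),
      ENNReal.ofReal (1 / (2 * (1 - (x ^ 2 + z ^ 2)))) =
    ENNReal.ofReal (catalanConstant / 3) := by
  have inner : ∀ x ∈ Set.Ioo (0 : ℝ) (1 / 2),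
      ∫⁻ z in Set.Ioo 0 x, ENNReal.ofReal (1 / (2 * (1 - (x ^ 2 + z ^ 2)))) =
      ∫⁻ t in Set.Ioo (0 : ℝ) 1, ENNReal.ofReal (x / (2 * (1 - x ^ 2 * (1 + t ^ 2)))) := by
    intro x hx
    rw [setLIntegral_Ioo_eq_mul_comp_mul hx.1]
    refine lintegral_congr fun t => ?_
    rw [← ENNReal.ofReal_mul hx.1.le]
    congr 1
    ring
  have hnonneg : ∀ t ∈ Set.Ioo (0 : ℝ) 1,
      0 ≤ 1 / 4 * (Real.log (4 / (3 - t ^ 2)) / (1 + t ^ 2)) := fun t ht => by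
    have ht2 : t ^ 2 < 1 := by nlinarith [ht.1, ht.2]
    have : 0 ≤ Real.log (4 / (3 - t ^ 2)) :=
      Real.log_nonneg ((one_le_div (by linarith)).2 (by nlinarith))
    positivity
  have hcont : ContinuousOn (fun t : ℝ => 1 / 4 * (Real.log (4 / (3 - t ^ 2)) / (1 + t ^ 2)))
      (Set.Icc 0 1) := by
    have h3 : ∀ t ∈ Set.Icc (0 : ℝ) 1, 0 < 3 - t ^ 2 := fun t ht => by nlinarith [ht.1, ht.2]
    refine ContinuousOn.mul (by fun_prop) (ContinuousOn.div (ContinuousOn.log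
      (ContinuousOn.div (by fun_prop) (by fun_prop) fun t ht => (h3 t ht).ne') fun t ht => ?_)
      (by fun_prop) fun t _ => by positivity)
    have := h3 t ht
    positivity
  rw [setLIntegral_Ioo_neg_self_of_even (fun x => by simp) (by norm_num),
    setLIntegral_setLIntegral_Ioo_of_symm (by simp only [Function.uncurry_def]; fun_prop)
      (fun x z => by rw [add_comm]),
    setLIntegral_congr_fun measurableSet_Ioo inner, lintegral_lintegral_swap (by
      simp only [Function.uncurry_def]; fun_prop),
    setLIntegral_congr_fun measurableSet_Ioo fun t ht => setLIntegral_Ioo_div_one_sub ht,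
    ← ofReal_integral_eq_lintegral_ofReal
      (hcont.integrableOn_Icc.mono_set Set.Ioo_subset_Icc_self)
      ((ae_restrict_mem measurableSet_Ioo).mono hnonneg),
    ← integral_Ioc_eq_integral_Ioo, ← intervalIntegral.integral_of_le zero_le_one,
    intervalIntegral.integral_const_mul, integral_log_four_div_three_sub_sq_div_one_add_sq,
    ← mul_assoc, show (2 * 2 : ENNReal) = ENNReal.ofReal 4 by norm_num,
    ← ENNReal.ofReal_mul (by norm_num)]
  congr 1
  ring

theorem integral_picard_domain_one_div_cube :
    ∫ p in {p : ℝ × ℝ × ℝ | -(1/2) < p.1 ∧ p.1 < 1/2 ∧ 0 < p.2.1 ∧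
        p.2.1 < 1/2 ∧ 0 < p.2.2 ∧ 1 < p.1 ^ 2 + p.2.1 ^ 2 + p.2.2 ^ 2}, 1 / p.2.2 ^ 3 =
      catalanConstant / 3 := by
  rw [integral_eq_lintegral_of_nonneg_ae, setLIntegral_picard_domain_one_div_cube,
    setLIntegral_Ioo_one_div_one_sub_sq_add_sq, ENNReal.toReal_ofReal]
  · linarith [catalanConstant_bounds.1]
  · refine (ae_restrict_mem (by measurability)).mono fun p hp => ?_
    have : 0 < p.2.2 := hp.2.2.2.2.1
    simp only [Pi.zero_apply]
    positivity
  · exact Measurable.aestronglyMeasurable (by fun_prop)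

/-- The hyperbolic volume of the standard fundamental domain
`F = {(x₀,x₁,y) : −1/2 < x₀ < 1/2, 0 < x₁ < 1/2, y > 0, x₀² + x₁² + y² > 1}` of the
Picard group equals `(1/(2π²)) Σ_{ν ∈ ℤ[i]∖{0}} (ν ν̄)^{−2}`, and numerically it is
`0.3053218647…`. -/
theorem picard_fundamental_domain_volume (V : ℝ)
    (hV : V = ∫ p in {p : ℝ × ℝ × ℝ | -(1/2) < p.1 ∧ p.1 < 1/2 ∧ 0 < p.2.1 ∧
        p.2.1 < 1/2 ∧ 0 < p.2.2 ∧ 1 < p.1 ^ 2 + p.2.1 ^ 2 + p.2.2 ^ 2}, 1 / p.2.2 ^ 3) :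
    V = 1 / (2 * Real.pi ^ 2) *
        ∑' ν : {ν : GaussianInt // ν ≠ 0}, (((ν.1 * star ν.1).re : ℝ)) ^ (-2 : ℤ) ∧
    0.3053218647 ≤ V ∧ V < 0.3053218648 := by
  rw [integral_picard_domain_one_div_cube] at hV
  subst hV
  refine ⟨?_, by linarith [catalanConstant_bounds.1], by linarith [catalanConstant_bounds.2]⟩
  rw [tsum_gaussianInt_norm_zpow]
  field_simp
  ring
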